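/- Let q ≥ 3 be an integer and λ = 2·cos(π/q). For every G_q-irrational x ∈ [−λ/2, λ/2) and every n ≥ 1 one has Θ_{n+1}(x) = ε_{n+2}·(1 − ε_{n+1}·r_{n+1}·t_n·λ)·(λ·r_{n+1} + ε_{n+1}·v_n)/(1 + t_n·v_n). -/

import Mathlib

noncomputable section

open Real Filter Topology MeasureTheory
open scoped Classical

namespace RosenTong

/-- `λ_q = 2 cos(π/q)`. -/
def lam (q : ℕ) : ℝ := 2 * Real.cos (Real.pi / q)

/-- The Rosen map `f_q` on `[-λ/2, λ/2)`. -/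
def f (l : ℝ) (x : ℝ) : ℝ :=
  if x = 0 then 0 else 1 / |x| - l * (⌊1 / (l * |x|) + 1 / 2⌋ : ℝ)

/-- `x` is `G_q`-irrational: its Rosen orbit never hits `0`. -/
def Irr (l : ℝ) (x : ℝ) : Prop := ∀ n : ℕ, (f l)^[n] x ≠ 0

/-- `ε_n = sign (f^{n-1} x)` (for `n ≥ 1`). -/
def eps (l x : ℝ) (n : ℕ) : ℝ := Real.sign ((f l)^[n - 1] x)

/-- `r_n = ⌊1/(λ |f^{n-1} x|) + 1/2⌋` (for `n ≥ 1`), as a real number. -/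
def rr (l x : ℝ) (n : ℕ) : ℝ := (⌊1 / (l * |(f l)^[n - 1] x|) + 1 / 2⌋ : ℝ)

/-- `((R_{n-1}, R_n), (S_{n-1}, S_n))`. -/
def RS (l x : ℝ) : ℕ → (ℝ × ℝ) × (ℝ × ℝ)
  | 0 => ((1, 0), (0, 1))
  | n + 1 =>
      (((RS l x n).1.2, rr l x (n + 1) * l * (RS l x n).1.2 + eps l x (n + 1) * (RS l x n).1.1),
       ((RS l x n).2.2, rr l x (n + 1) * l * (RS l x n).2.2 + eps l x (n + 1) * (RS l x n).2.1))

/-- Numerator `R_n` of the `n`-th Rosen convergent. -/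
def Rnum (l x : ℝ) (n : ℕ) : ℝ := (RS l x n).1.2

/-- Denominator `S_n` of the `n`-th Rosen convergent. -/
def Snum (l x : ℝ) (n : ℕ) : ℝ := (RS l x n).2.2

/-- The approximation coefficient `Θ_n = S_n² |x - R_n/S_n|`. -/
def theta (l x : ℝ) (n : ℕ) : ℝ := (Snum l x n) ^ 2 * |x - Rnum l x n / Snum l x n|

/-- The natural extension map `𝒯(x,y) = (f x, 1/(r(x)λ + ε(x) y))`. -/
def T (l : ℝ) (z : ℝ × ℝ) : ℝ × ℝ :=
  (f l z.1, 1 / ((⌊1 / (l * |z.1|) + 1 / 2⌋ : ℝ) * l + Real.sign z.1 * z.2))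

/-- `(t_n, v_n) = 𝒯^n (x, 0)`. -/
def tv (l x : ℝ) (n : ℕ) : ℝ × ℝ := (T l)^[n] (x, 0)

/-- `G(y) = -1/(λ + y)`. -/
def G (l : ℝ) (y : ℝ) : ℝ := -1 / (l + y)

/-- `C(y) = -1/(2λ + y)`. -/
def CC (l : ℝ) (y : ℝ) : ℝ := -1 / (2 * l + y)

/-- `τ_k` in the even case `q = 2p`. -/
def tauE (l : ℝ) (p : ℕ) : ℕ → ℝ
  | 0 => -2 / (3 * l)
  | k + 1 => -1 / (2 * l + (G l)^[p - 2] (tauE l p k))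

/-- `τ_k` in the odd case `q = 2h+3`. -/
def tauO (l : ℝ) (h : ℕ) : ℕ → ℝ
  | 0 => -2 / (3 * l)
  | k + 1 => CC l ((G l)^[h] (CC l ((G l)^[h - 1] (tauO l h k))))

/-- `φ_j = f^j(-λ/2)`. -/
def phi (l : ℝ) (j : ℕ) : ℝ := (f l)^[j] (-(l / 2))

/-- The heights `L_j` in the even case: `L_1 = 1/(λ+1)`, `L_j = 1/(λ - L_{j-1})`. -/
def LE (l : ℝ) : ℕ → ℝ
  | 0 => 0
  | 1 => 1 / (l + 1)
  | j + 2 => 1 / (l - LE l (j + 1))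

/-- The natural extension domain `Ω` in the even case `q = 2p`. -/
def OmegaE (l : ℝ) (p : ℕ) : Set (ℝ × ℝ) :=
  (⋃ j ∈ Finset.Icc 1 (p - 1),
    (Set.Ico (phi l (j - 1)) (phi l j)) ×ˢ (Set.Icc 0 (LE l j)))
  ∪ (Set.Ico (0 : ℝ) (l / 2)) ×ˢ (Set.Icc (0 : ℝ) 1)

/-- The region `D` (even case): both `Θ_{n-1}` and `Θ_n` exceed `1/2`. -/
def DE (l : ℝ) (p : ℕ) : Set (ℝ × ℝ) :=
  {z ∈ OmegaE l p | z.2 / (1 + z.1 * z.2) > 1 / 2 ∧ |z.1| / (1 + z.1 * z.2) > 1 / 2}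

/-- The region `A = {(t,v) ∈ D : -2/(3λ) ≤ t ≤ -1/(λ+1)}`. -/
def AE (l : ℝ) (p : ℕ) : Set (ℝ × ℝ) :=
  {z ∈ DE l p | -2 / (3 * l) ≤ z.1 ∧ z.1 ≤ -1 / (l + 1)}

/-- `A_k = {(t,v) ∈ A : t ≥ τ_k}`. -/
def AEk (l : ℝ) (p k : ℕ) : Set (ℝ × ℝ) :=
  {z ∈ AE l p | tauE l p k ≤ z.1}

/-- The invariant measure `ν` (even case), with density `C_q/(1+tv)²` on `Ω`. -/
def nuE (q p : ℕ) : Measure (ℝ × ℝ) :=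
  (volume.restrict (OmegaE (lam q) p)).withDensity fun z =>
    ENNReal.ofReal
      ((1 / Real.log ((1 + Real.cos (Real.pi / q)) / Real.sin (Real.pi / q))) /
        (1 + z.1 * z.2) ^ 2)

/-- The Hurwitz constant `H_q` for odd `q`. -/
def Hodd (l : ℝ) : ℝ := 1 / (2 * Real.sqrt ((1 - l / 2) ^ 2 + 1) )

/-- The positive root `R` of `R² + (2-λ)R - 1 = 0` (odd case). -/
def Rodd (l : ℝ) : ℝ := (l - 2 + Real.sqrt ((2 - l) ^ 2 + 4)) / 2

/-- Barriers `φ_j` in the first coordinate with matching heights `M_j` in the second one,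
which confine the orbits `𝒯^n (x, 0)`. -/
structure Staircase (l : ℝ) (m : ℕ) (φ M : ℕ → ℝ) : Prop where
  one_le : 1 ≤ l
  lt_two : l < 2
  pos : 1 ≤ m
  phi_zero : φ 0 = -(l / 2)
  phi_neg : ∀ j, j + 2 ≤ m → φ j < 0
  phi_succ : ∀ j, j + 2 ≤ m → φ (j + 1) = -1 / φ j - l
  M_lt : ∀ j, j < m → M j < l
  M_succ : ∀ j, j < m → M (j + 1) = 1 / (l - M j)
  M_last : M m = 1
  phi_last : -2 / (3 * l) ≤ φ (m - 1)
  parity : M 0 = 0 ∨ M 0 = -1 ∧ φ (m - 1) = 0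

/-- The points lying under the staircase. -/
def UnderStaircase (l : ℝ) (m : ℕ) (φ M : ℕ → ℝ) (z : ℝ × ℝ) : Prop :=
  -(l / 2) ≤ z.1 ∧ z.1 ≤ l / 2 ∧ 0 ≤ z.2 ∧ z.2 ≤ 1 ∧ ∀ j, j < m → z.1 < φ j → z.2 ≤ M j

namespace Staircase

variable {l : ℝ} {m : ℕ} {φ M : ℕ → ℝ}

lemma M_pos (h : Staircase l m φ M) {j : ℕ} (hj : j < m) : 0 < M (j + 1) := by
  rw [h.M_succ j hj]
  exact one_div_pos.2 (sub_pos.2 (h.M_lt j hj))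

lemma M_one_le (h : Staircase l m φ M) {j : ℕ} (hj : j < m) : M 1 ≤ M (j + 1) := by
  induction j with
  | zero => exact le_rfl
  | succ j ih =>
    refine (ih (by omega)).trans ?_
    rw [h.M_succ (j + 1) hj, le_div_iff₀ (sub_pos.2 (h.M_lt _ hj))]
    nlinarith [sq_nonneg (M (j + 1) - l / 2), h.one_le, h.lt_two]

lemma M_one (h : Staircase l m φ M) : M 1 = 1 / (l - M 0) := h.M_succ 0 h.pos

lemma M_pred_last (h : Staircase l m φ M) : M (m - 1) = l - 1 := by
  have hm := h.pos
  have h1 := h.M_succ (m - 1) (by omega)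
  have h2 := h.M_lt (m - 1) (by omega)
  rw [Nat.sub_add_cancel hm, h.M_last, eq_div_iff (by linarith)] at h1
  linarith

end Staircase

/-- The Rosen digit of a nonzero point of the interval, with its defining inequalities. -/
lemma digit_bounds {l t : ℝ} (h1 : 1 ≤ l) (h2 : l < 2) (ht : t ≠ 0) (hl : |t| ≤ l / 2) :
    ∃ r : ℤ, ⌊1 / (l * |t|) + 1 / 2⌋ = r ∧ 1 ≤ r ∧ f l t = 1 / |t| - l * r ∧
      -(l / 2) ≤ f l t ∧ f l t ≤ l / 2 := by
  have hp : 0 < |t| := abs_pos.2 ht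
  refine ⟨_, rfl, ?_, by simp [f, ht], ?_⟩
  · rw [Int.le_floor]
    have : 1 / 2 ≤ 1 / (l * |t|) := by
      apply one_div_le_one_div_of_le (by positivity)
      nlinarith
    push_cast
    linarith
  · have ha := Int.floor_le (1 / (l * |t|) + 1 / 2)
    have hb := Int.lt_floor_add_one (1 / (l * |t|) + 1 / 2)
    have he : 1 / |t| = l * (1 / (l * |t|)) := by field_simp
    simp only [f, ht, if_false]
    rw [he]
    constructor <;> nlinarith

lemma Staircase.step {l : ℝ} {m : ℕ} {φ M : ℕ → ℝ} (h : Staircase l m φ M) {z : ℝ × ℝ}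
    (hz : UnderStaircase l m φ M z) (h0 : z.1 ≠ 0) :
    0 < (⌊1 / (l * |z.1|) + 1 / 2⌋ : ℝ) * l + Real.sign z.1 * z.2 ∧
      UnderStaircase l m φ M (T l z) := by
  obtain ⟨t, v⟩ := z
  obtain ⟨ht1, ht2, hv0, hv1, hM⟩ := hz
  simp only at ht1 ht2 hv0 hv1 hM h0
  have hl1 := h.one_le
  have hl2 := h.lt_two
  have hm := h.pos
  have habs : |t| ≤ l / 2 := abs_le.2 ⟨ht1, ht2⟩
  have hp : 0 < |t| := abs_pos.2 h0
  obtain ⟨r, hr, hr1, hf, hf1, hf2⟩ := digit_bounds hl1 hl2 h0 habs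
  simp only [UnderStaircase, T, hr]
  -- it suffices to bound the new denominator from below
  suffices H : 1 ≤ (r : ℝ) * l + Real.sign t * v ∧
      ∀ j, j + 1 < m → f l t < φ (j + 1) →
        1 / ((r : ℝ) * l + Real.sign t * v) ≤ M (j + 1) by
    obtain ⟨H1, H2⟩ := H
    refine ⟨by linarith, hf1, hf2, by positivity, ?_, ?_⟩
    · rw [div_le_one (by linarith)]; exact H1
    · intro j hj hlt
      cases j with
      | zero => rw [h.phi_zero] at hlt; linarith
      | succ j => exact H2 j hj hlt
  rcases eq_or_lt_of_le hr1 with hr1 | hr2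
  · -- digit one
    rw [← hr1] at hr hf ⊢
    have hr' : |t| > 2 / (3 * l) := by
      have hb := Int.lt_floor_add_one (1 / (l * |t|) + 1 / 2)
      rw [hr] at hb
      push_cast at hb
      have : 1 / (l * |t|) < 3 / 2 := by linarith
      rw [div_lt_iff₀ (by positivity)] at this
      rw [gt_iff_lt, div_lt_iff₀ (by positivity)]
      linarith
    push_cast at hf ⊢
    rcases lt_or_gt_of_ne h0 with hn | hpos
    · rw [Real.sign_of_neg hn]
      rw [abs_of_neg hn] at hf hr'
      have hlast : t < φ (m - 1) := by
        have := h.phi_last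
        rw [neg_div] at this
        linarith
      have hvl := hM (m - 1) (by omega) hlast
      rw [h.M_pred_last] at hvl
      refine ⟨by linarith, fun j hj hlt => ?_⟩
      rw [h.M_succ j (by omega)]
      have hvj : v ≤ M j := by
        apply hM j (by omega)
        rw [hf, h.phi_succ j (by omega)] at hlt
        have hneg := h.phi_neg j (by omega)
        have h3 : 1 / (-t) < 1 / (-φ j) := by
          have : -1 / φ j = 1 / (-φ j) := by rw [div_neg, neg_div]
          linarith
        have := lt_of_one_div_lt_one_div (by linarith) h3
        linarith
      apply one_div_le_one_div_of_le (sub_pos.2 (h.M_lt j (by omega)))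
      linarith
    · rw [Real.sign_of_pos hpos]
      refine ⟨by linarith, fun j hj hlt => ?_⟩
      cases j with
      | zero =>
        exfalso
        rw [hf, h.phi_succ 0 (by omega), h.phi_zero] at hlt
        have h3 : -1 / (-(l / 2)) = 1 / (l / 2) := by rw [div_neg, neg_div, neg_neg]
        have h4 : 1 / (l / 2) ≤ 1 / |t| := one_div_le_one_div_of_le hp habs
        linarith
      | succ j =>
        rw [h.M_succ (j + 1) (by omega)]
        have := h.M_pos (j := j) (by omega)
        apply one_div_le_one_div_of_le (sub_pos.2 (h.M_lt _ (by omega)))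
        linarith
  · -- digit at least two
    have hr2' : (2 : ℝ) ≤ r := by exact_mod_cast hr2
    have hrl : 2 * l ≤ r * l := by nlinarith
    have key : l - M 0 ≤ r * l + Real.sign t * v ∧ 1 ≤ r * l + Real.sign t * v := by
      rcases lt_or_gt_of_ne h0 with hn | hpos
      · rw [Real.sign_of_neg hn]
        refine ⟨?_, by linarith⟩
        rcases h.parity with hp0 | ⟨hp0, hp1⟩
        · rw [hp0]; linarith
        · have hvl := hM (m - 1) (by omega) (by rw [hp1]; exact hn)
          rw [h.M_pred_last] at hvl
          rw [hp0]; linarith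
      · rw [Real.sign_of_pos hpos]
        refine ⟨?_, by linarith⟩
        rcases h.parity with hp0 | ⟨hp0, hp1⟩ <;> rw [hp0] <;> linarith
    refine ⟨key.2, fun j hj _ => ?_⟩
    refine le_trans ?_ (h.M_one_le (j := j) (by omega))
    rw [h.M_one]
    exact one_div_le_one_div_of_le (sub_pos.2 (h.M_lt 0 (by omega))) key.1

lemma one_le_lam {q : ℕ} (hq : 3 ≤ q) : 1 ≤ lam q := by
  have hq' : (3 : ℝ) ≤ q := by exact_mod_cast hq
  have h1 : Real.pi / q ≤ Real.pi / 3 :=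
    div_le_div_of_nonneg_left Real.pi_pos.le (by norm_num) hq'
  have h2 := Real.cos_le_cos_of_nonneg_of_le_pi (by positivity)
    (by linarith [Real.pi_pos]) h1
  rw [Real.cos_pi_div_three] at h2
  unfold lam
  linarith

lemma lam_lt_two {q : ℕ} (hq : 3 ≤ q) : lam q < 2 := by
  have hq' : (3 : ℝ) ≤ q := by exact_mod_cast hq
  have h1 : Real.pi / q ≤ Real.pi / 3 :=
    div_le_div_of_nonneg_left Real.pi_pos.le (by norm_num) hq'
  have h2 := Real.cos_lt_cos_of_nonneg_of_le_pi le_rfl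
    (by linarith [Real.pi_pos]) (show 0 < Real.pi / q from by have := Real.pi_pos; positivity)
  rw [Real.cos_zero] at h2
  unfold lam
  linarith

/-- The trigonometric staircase; `d = 0` for odd `q` and `d = 1/2` for even `q`. -/
lemma staircase_of_trig {q m : ℕ} {d : ℝ} (hq : 3 ≤ q) (hm : 1 ≤ m)
    (hd : d = 0 ∨ d = 1 / 2) (hqm : (q : ℝ) = 2 * m + 1 - 2 * d) :
    Staircase (lam q) m
      (fun j => -(Real.cos ((j + 1) * (Real.pi / q)) / Real.cos (j * (Real.pi / q))))
      (fun j => Real.sin ((j - d) * (Real.pi / q)) / Real.sin ((j + 1 - d) * (Real.pi / q))) := by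
  have hq' : (3 : ℝ) ≤ q := by exact_mod_cast hq
  have hd0 : 0 ≤ d := by rcases hd with h | h <;> simp [h]
  have hd1 : d ≤ 1 / 2 := by rcases hd with h | h <;> rw [h]; norm_num
  have hpi := Real.pi_pos
  set θ := Real.pi / q with hθ
  have hθ0 : 0 < θ := by positivity
  have hqθ : q * θ = Real.pi := by rw [hθ]; field_simp
  have hlam : lam q = 2 * Real.cos θ := rfl
  have hone := one_le_lam hq
  have htwo := lam_lt_two hq
  have hcos : ∀ a : ℝ, 0 ≤ a → 2 * a < q → 0 < Real.cos (a * θ) := fun a h1 h2 =>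
    Real.cos_pos_of_mem_Ioo ⟨by nlinarith, by nlinarith⟩
  have hsin : ∀ a : ℝ, 0 < a → a < q → 0 < Real.sin (a * θ) := fun a h1 h2 =>
    Real.sin_pos_of_pos_of_lt_pi (by positivity) (by nlinarith)
  have hcast : ∀ {j k : ℕ}, j ≤ k → (j : ℝ) ≤ k := fun h => by exact_mod_cast h
  have hdiff : ∀ j : ℕ, j < m → lam q - Real.sin ((j - d) * θ) / Real.sin ((j + 1 - d) * θ) =
      Real.sin ((j + 2 - d) * θ) / Real.sin ((j + 1 - d) * θ) := by
    intro j hj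
    have hj' := hcast (Nat.succ_le_of_lt hj)
    push_cast at hj'
    have hj0 : (0 : ℝ) ≤ j := by positivity
    have := hsin (j + 1 - d) (by linarith) (by linarith)
    rw [sub_eq_iff_eq_add, ← add_div, eq_div_iff this.ne', hlam,
      show (j + 2 - d) * θ = (j + 1 - d) * θ + θ by ring,
      show (j - d) * θ = (j + 1 - d) * θ - θ by ring, Real.sin_add, Real.sin_sub]
    ring
  have hdpos : ∀ j : ℕ, j < m →
      0 < Real.sin ((j + 2 - d) * θ) / Real.sin ((j + 1 - d) * θ) := by
    intro j hj
    have hj' := hcast (Nat.succ_le_of_lt hj)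
    push_cast at hj'
    have hj0 : (0 : ℝ) ≤ j := by positivity
    exact div_pos (hsin _ (by linarith) (by linarith)) (hsin _ (by linarith) (by linarith))
  refine ⟨hone, htwo, hm, ?_, ?_, ?_, ?_, ?_, ?_, ?_, ?_⟩
  · simp [hlam]
  · intro j hj
    have hj' := hcast hj
    push_cast at hj'
    have hj0 : (0 : ℝ) ≤ j := by positivity
    exact neg_neg_of_pos
      (div_pos (hcos _ (by linarith) (by linarith)) (hcos _ (by linarith) (by linarith)))
  · intro j hj
    have hj' := hcast hj
    push_cast at hj'
    have hj0 : (0 : ℝ) ≤ j := by positivity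
    have h1 := hcos (j + 1) (by linarith) (by linarith)
    have h2 := hcos j (by linarith) (by linarith)
    push_cast
    rw [neg_div_neg_eq, one_div_div, eq_sub_iff_add_eq, neg_add_eq_iff_eq_add, ← add_div,
      eq_div_iff h1.ne', hlam, show ((j : ℝ) + 1 + 1) * θ = (j + 1) * θ + θ by ring,
      show (j : ℝ) * θ = (j + 1) * θ - θ by ring, Real.cos_add, Real.cos_sub]
    ring
  · intro j hj
    have := hdpos j hj
    rw [← hdiff j hj] at this
    linarith
  · intro j hj
    rw [hdiff j hj, one_div_div]
    push_cast
    ring_nf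
  · have hm' : (1 : ℝ) ≤ m := by exact_mod_cast hm
    have h1 := hsin (m + 1 - d) (by linarith) (by linarith)
    rw [div_eq_one_iff_eq h1.ne', ← Real.sin_pi_sub, ← hqθ, hqm]
    ring_nf
  · have hm' : (1 : ℝ) ≤ m := by exact_mod_cast hm
    simp only [Nat.cast_sub hm, Nat.cast_one, sub_add_cancel]
    rcases hd with rfl | rfl
    · have e1 : (m : ℝ) * θ = Real.pi / 2 - θ / 2 := by rw [← hqθ, hqm]; ring
      have e2 : ((m : ℝ) - 1) * θ = Real.pi / 2 - 3 * (θ / 2) := by rw [← hqθ, hqm]; ring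
      have hs : 0 < Real.sin (θ / 2) := by
        have := hsin (1 / 2) (by norm_num) (by linarith)
        rwa [show 1 / 2 * θ = θ / 2 by ring] at this
      have hcos2 : Real.cos θ = 1 - 2 * Real.sin (θ / 2) ^ 2 := by
        have := Real.cos_sq' (θ / 2)
        have h2 := Real.cos_two_mul (θ / 2)
        rw [show 2 * (θ / 2) = θ by ring] at h2
        linarith
      have e3 : Real.sin (3 * (θ / 2)) = Real.sin (θ / 2) * (1 + lam q) := by
        rw [Real.sin_three_mul, hlam, hcos2]; ring
      rw [e1, e2, Real.cos_pi_div_two_sub, Real.cos_pi_div_two_sub, e3, neg_div, neg_le_neg_iff,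
        div_mul_cancel_left₀ hs.ne', ← one_div, div_le_div_iff₀ (by linarith) (by linarith)]
      linarith
    · have e1 : (m : ℝ) * θ = Real.pi / 2 := by rw [← hqθ, hqm]; ring
      rw [e1, Real.cos_pi_div_two, zero_div, neg_zero]
      exact div_nonpos_of_nonpos_of_nonneg (by norm_num) (by linarith)
  · rcases hd with rfl | rfl
    · left; simp
    · right
      constructor
      · have hs := hsin (1 / 2) (by norm_num) (by linarith)
        simp only [Nat.cast_zero, zero_sub, zero_add]
        rw [show (1 : ℝ) - 1 / 2 = 1 / 2 by norm_num, neg_mul, Real.sin_neg, neg_div,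
          div_self hs.ne']
      · have e1 : (m : ℝ) * θ = Real.pi / 2 := by rw [← hqθ, hqm]; ring
        simp only [Nat.cast_sub hm, Nat.cast_one, sub_add_cancel]
        rw [e1, Real.cos_pi_div_two, zero_div, neg_zero]

lemma exists_staircase {q : ℕ} (hq : 3 ≤ q) : ∃ m φ M, Staircase (lam q) m φ M := by
  rcases Nat.even_or_odd' q with ⟨m, rfl | rfl⟩
  · exact ⟨m, _, _, staircase_of_trig (d := 1 / 2) hq (by omega) (Or.inr rfl)
      (by push_cast; ring)⟩
  · exact ⟨m, _, _, staircase_of_trig (d := 0) hq (by omega) (Or.inl rfl)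
      (by push_cast; ring)⟩

lemma Staircase.start {l : ℝ} {m : ℕ} {φ M : ℕ → ℝ} (h : Staircase l m φ M) {x : ℝ}
    (hx : x ∈ Set.Ico (-(l / 2)) (l / 2)) : UnderStaircase l m φ M (x, 0) := by
  refine ⟨hx.1, hx.2.le, le_rfl, zero_le_one, fun j hj hlt => ?_⟩
  cases j with
  | zero =>
    rw [h.phi_zero] at hlt
    exact absurd hx.1 (not_le.2 hlt)
  | succ j => exact (h.M_pos (by omega)).le

lemma tv_fst (l x : ℝ) (n : ℕ) : (tv l x n).1 = (f l)^[n] x := by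
  induction n with
  | zero => rfl
  | succ n ih =>
    rw [tv, Function.iterate_succ_apply', Function.iterate_succ_apply', ← ih]
    rfl

lemma tv_snd_succ (l x : ℝ) (n : ℕ) :
    (tv l x (n + 1)).2 = 1 / (rr l x (n + 1) * l + eps l x (n + 1) * (tv l x n).2) := by
  rw [rr, eps, Nat.add_sub_cancel, ← tv_fst, tv, Function.iterate_succ_apply']
  rfl

lemma tv_fst_succ {l x : ℝ} {n : ℕ} (h : (tv l x n).1 ≠ 0) :
    (tv l x (n + 1)).1 = 1 / |(tv l x n).1| - l * rr l x (n + 1) := by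
  rw [rr, Nat.add_sub_cancel, ← tv_fst, tv, Function.iterate_succ_apply']
  change f l (tv l x n).1 = _
  rw [f, if_neg h]

lemma eps_succ (l x : ℝ) (n : ℕ) : eps l x (n + 1) = Real.sign (tv l x n).1 := by
  rw [eps, Nat.add_sub_cancel, tv_fst]

/-- The denominators of the natural extension map are positive along the orbit of `(x, 0)`. -/
lemma denominator_pos {q : ℕ} (hq : 3 ≤ q) {x : ℝ}
    (hx : x ∈ Set.Ico (-(lam q / 2)) (lam q / 2)) (hirr : Irr (lam q) x) (n : ℕ) :
    0 < rr (lam q) x (n + 1) * lam q + eps (lam q) x (n + 1) * (tv (lam q) x n).2 := by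
  obtain ⟨m, φ, M, h⟩ := exists_staircase hq
  have hne : ∀ n, (tv (lam q) x n).1 ≠ 0 := fun n => by rw [tv_fst]; exact hirr n
  have hU : ∀ n, UnderStaircase (lam q) m φ M (tv (lam q) x n) := by
    intro n
    induction n with
    | zero => exact h.start hx
    | succ n ih =>
      have := (h.step ih (hne n)).2
      rwa [tv, ← Function.iterate_succ_apply' (T (lam q))] at this
  have := (h.step (hU n) (hne n)).1
  rwa [rr, eps, Nat.add_sub_cancel, ← tv_fst]

lemma sign_mul_abs_eq (t : ℝ) : Real.sign t * |t| = t := by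
  rcases lt_trichotomy t 0 with h | rfl | h
  · rw [Real.sign_of_neg h, abs_of_neg h]; ring
  · simp
  · rw [Real.sign_of_pos h, abs_of_pos h]; ring

lemma sign_mul_self_eq_abs (t : ℝ) : Real.sign t * t = |t| := by
  rcases lt_trichotomy t 0 with h | rfl | h
  · rw [Real.sign_of_neg h, abs_of_neg h]; ring
  · simp
  · rw [Real.sign_of_pos h, abs_of_pos h]; ring

/-- The standard relations between convergents and the natural extension orbit. -/
lemma convergent_relations {l x : ℝ} (hne : ∀ n, (tv l x n).1 ≠ 0)
    (hden : ∀ n, 0 < rr l x (n + 1) * l + eps l x (n + 1) * (tv l x n).2) (n : ℕ) :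
    0 < (RS l x n).2.2 ∧ (RS l x n).2.1 = (tv l x n).2 * (RS l x n).2.2 ∧
      0 < (RS l x n).2.2 + (tv l x n).1 * (RS l x n).2.1 ∧
      x * ((RS l x n).2.2 + (tv l x n).1 * (RS l x n).2.1) =
        (RS l x n).1.2 + (tv l x n).1 * (RS l x n).1.1 ∧
      |(RS l x n).1.1 * (RS l x n).2.2 - (RS l x n).1.2 * (RS l x n).2.1| = 1 := by
  induction n with
  | zero => simp [RS, tv]
  | succ n ih =>
    obtain ⟨h1, h2, h3, h4, h5⟩ := ih
    have hd := hden n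
    have ht := hne n
    have hs := sign_mul_abs_eq (tv l x n).1
    have hp : 0 < |(tv l x n).1| := abs_pos.2 ht
    rw [tv_fst_succ ht, tv_snd_succ]
    simp only [RS]
    rw [eps_succ] at hd ⊢
    generalize rr l x (n + 1) = r at *
    generalize (RS l x n).1.1 = R' at *
    generalize (RS l x n).1.2 = R at *
    generalize (RS l x n).2.1 = S' at *
    generalize (RS l x n).2.2 = S at *
    generalize (tv l x n).2 = v at *
    generalize (tv l x n).1 = t at *
    have hS : r * l * S + t.sign * S' = (r * l + t.sign * v) * S := by rw [h2]; ring
    have hSt : ∀ A B : ℝ, r * l * A + t.sign * B + (1 / |t| - l * r) * A = (A + t * B) / |t| := by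
      intro A B
      rw [eq_div_iff hp.ne']
      have : 1 / |t| * |t| = 1 := one_div_mul_cancel hp.ne'
      linear_combination B * hs + A * this
    refine ⟨by rw [hS]; positivity, ?_, ?_, ?_, ?_⟩
    · rw [hS]
      field_simp
    · rw [hSt]; positivity
    · rw [hSt, hSt, ← h4]; ring
    · have : R * (r * l * S + t.sign * S') - (r * l * R + t.sign * R') * S =
          -t.sign * (R' * S - R * S') := by ring
      rw [this, abs_mul, h5, abs_neg, mul_one]
      rcases Real.sign_apply_eq_of_ne_zero t ht with h | h <;> simp [h]

/-- `Θ_n = |t_n| / (1 + t_n v_n)`, together with positivity of the denominator. -/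
lemma theta_eq {l x : ℝ} (hne : ∀ n, (tv l x n).1 ≠ 0)
    (hden : ∀ n, 0 < rr l x (n + 1) * l + eps l x (n + 1) * (tv l x n).2) (n : ℕ) :
    0 < 1 + (tv l x n).1 * (tv l x n).2 ∧
      theta l x n = |(tv l x n).1| / (1 + (tv l x n).1 * (tv l x n).2) := by
  obtain ⟨h1, h2, h3, h4, h5⟩ := convergent_relations hne hden n
  simp only [theta, Snum, Rnum]
  generalize (RS l x n).1.1 = R' at *
  generalize (RS l x n).1.2 = R at *
  generalize (RS l x n).2.1 = S' at *
  generalize (RS l x n).2.2 = S at *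
  generalize (tv l x n).2 = v at *
  generalize (tv l x n).1 = t at *
  have hfac : S + t * S' = S * (1 + t * v) := by rw [h2]; ring
  have hpos : 0 < 1 + t * v := by
    rw [hfac] at h3
    exact (mul_pos_iff_of_pos_left h1).1 h3
  refine ⟨hpos, ?_⟩
  have hx : x - R / S = t * (R' * S - R * S') / (S ^ 2 * (1 + t * v)) := by
    rw [eq_div_iff (by positivity)]
    have : R / S * S = R := div_mul_cancel₀ _ h1.ne'
    rw [hfac] at h4
    linear_combination S * h4 - S * (1 + t * v) * this + R * t * h2
  rw [hx, abs_div, abs_mul, h5, abs_of_pos (show 0 < S ^ 2 * (1 + t * v) by positivity)]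
  field_simp

/-- the formula for `Θ_{n+1}` in terms of `(t_n, v_n)`. -/
theorem theta_succ_formula (q : ℕ) (hq : 3 ≤ q)
    (x : ℝ) (hx : x ∈ Set.Ico (-(lam q / 2)) (lam q / 2)) (hirr : Irr (lam q) x)
    (n : ℕ) (hn : 1 ≤ n) :
    theta (lam q) x (n + 1) =
      eps (lam q) x (n + 2) *
        (1 - eps (lam q) x (n + 1) * rr (lam q) x (n + 1) * (tv (lam q) x n).1 * lam q) *
        (lam q * rr (lam q) x (n + 1) + eps (lam q) x (n + 1) * (tv (lam q) x n).2) /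
        (1 + (tv (lam q) x n).1 * (tv (lam q) x n).2) := by
  have hne : ∀ n, (tv (lam q) x n).1 ≠ 0 := fun n => by rw [tv_fst]; exact hirr n
  have hden := denominator_pos hq hx hirr
  have hpos := (theta_eq hne hden n).1
  obtain ⟨hpos', hθ⟩ := theta_eq hne hden (n + 1)
  have hd := hden n
  have ht := hne n
  have hs := sign_mul_abs_eq (tv (lam q) x n).1
  have hp : 0 < |(tv (lam q) x n).1| := abs_pos.2 ht
  rw [hθ, ← sign_mul_self_eq_abs, eps_succ _ _ (n + 1), div_eq_div_iff hpos'.ne' hpos.ne',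
    tv_snd_succ, tv_fst_succ ht, eps_succ]
  rw [eps_succ] at hd
  clear hpos hpos' hθ hden hne
  generalize rr (lam q) x (n + 1) = r at *
  generalize (tv (lam q) x n).2 = v at *
  generalize (tv (lam q) x n).1 = t at *
  generalize lam q = l at *
  generalize Real.sign (1 / |t| - l * r) = e at *
  have hinv : 1 / |t| * |t| = 1 := one_div_mul_cancel hp.ne'
  have hD : (1 / (r * l + t.sign * v)) * (r * l + t.sign * v) = 1 := one_div_mul_cancel hd.ne'
  have hu : 1 - t.sign * r * t * l = |t| * (1 / |t| - l * r) := by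
    linear_combination -hinv - r * l * sign_mul_self_eq_abs t
  have hw : (l * r + t.sign * v) * (1 + (1 / |t| - l * r) * (1 / (r * l + t.sign * v))) =
      t.sign * v + 1 / |t| := by
    linear_combination (1 / |t| - l * r) * hD
  rw [hu]
  linear_combination -e * |t| * (1 / |t| - l * r) * hw - e * (1 / |t| - l * r) * v * hs
    - e * (1 / |t| - l * r) * hinv

end RosenTong
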